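/- The number of isomorphism classes of left braces $(B,+,\cdot)$ with additive group $(B,+)$ isomorphic to $C_2\times C_2\times C_4\times C_4$ and multiplicative group $(B,\cdot)$ elementary abelian of order $64$ (i.e., isomorphic to $C_2^6$) is $46$. -/

import Mathlib

/-- A left brace structure on a set `B`: an abelian group operation `+` (with
zero element `zero` and negation `neg`), a group operation `*` (with identity
`one` and inversion `inv`), linked by the relation
`x * (y + z) = x * y - x + x * z`, i.e. `x * (y + z) = (x * y + (-x)) + x * z`. -/
structure LeftBrace (B : Type*) where
  add : B → B → B
  zero : B
  neg : B → B
  mul : B → B → B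
  one : B
  inv : B → B
  add_assoc : ∀ a b c, add (add a b) c = add a (add b c)
  add_comm : ∀ a b, add a b = add b a
  zero_add : ∀ a, add zero a = a
  neg_add_cancel : ∀ a, add (neg a) a = zero
  mul_assoc : ∀ a b c, mul (mul a b) c = mul a (mul b c)
  one_mul : ∀ a, mul one a = a
  mul_one : ∀ a, mul a one = a
  inv_mul_cancel : ∀ a, mul (inv a) a = one
  brace : ∀ x y z, mul x (add y z) = add (add (mul x y) (neg x)) (mul x z)

/-- Two left braces are isomorphic if there is a bijection preserving both
operations. -/
def LeftBrace.Iso {B₁ B₂ : Type*} (L₁ : LeftBrace B₁) (L₂ : LeftBrace B₂) : Prop :=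
  ∃ e : B₁ ≃ B₂, (∀ x y, e (L₁.add x y) = L₂.add (e x) (e y)) ∧
    (∀ x y, e (L₁.mul x y) = L₂.mul (e x) (e y))

/-- The additive group of the left brace `L` is isomorphic to the
(additively written) abelian group `A`. -/
def LeftBrace.AddIso {B : Type*} (L : LeftBrace B) (A : Type*) [AddGroup A] : Prop :=
  ∃ e : B ≃ A, ∀ x y, e (L.add x y) = e x + e y

/-- The multiplicative group of the left brace `L` is isomorphic to the
(additively written) group `A`. -/
def LeftBrace.MulIso {B : Type*} (L : LeftBrace B) (A : Type*) [AddGroup A] : Prop :=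
  ∃ e : B ≃ A, ∀ x y, e (L.mul x y) = e x + e y

namespace BraceCount

/-- Codes: the six products `e0e1, e0f0, e0f1, e1f0, e1f1, f0f1`. -/
structure Code where
  a : ℕ
  b : ℕ
  c : ℕ
  d : ℕ
  e : ℕ
  f : ℕ

def cd (p : Bool) (w : ℕ) : ℕ := cond p w 0

def phi (s : Code) (x y : ℕ) : ℕ :=
  (cd (x.testBit 0) (cd (y.testBit 1) s.a ^^^ cd (y.testBit 2) s.b ^^^ cd (y.testBit 3) s.c)) ^^^
  (cd (x.testBit 1) (cd (y.testBit 0) s.a ^^^ cd (y.testBit 2) s.d ^^^ cd (y.testBit 3) s.e)) ^^^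
  (cd (x.testBit 2) (cd (y.testBit 0) s.b ^^^ cd (y.testBit 1) s.d ^^^ cd (y.testBit 2) 4 ^^^ cd (y.testBit 3) s.f)) ^^^
  (cd (x.testBit 3) (cd (y.testBit 0) s.c ^^^ cd (y.testBit 1) s.e ^^^ cd (y.testBit 2) s.f ^^^ cd (y.testBit 3) 8))

def gw (i : ℕ) (k : ℕ) (w : ℕ) : ℕ := w ^^^ cd (w.testBit i) k

inductive Gen where
  | e0e1 | e1e0 | f0f1 | f1f0 | f0e0 | f0e1 | f1e0 | f1e1 | e0F0 | e0F1 | e1F0 | e1F1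

def mapC (h : ℕ → ℕ) (s : Code) : Code := ⟨h s.a, h s.b, h s.c, h s.d, h s.e, h s.f⟩

def act : Gen → Code → Code
  | .e0e1, s => mapC (gw 0 2) ⟨s.a, s.b ^^^ s.d, s.c ^^^ s.e, s.d, s.e, s.f⟩
  | .e1e0, s => mapC (gw 1 1) ⟨s.a, s.b, s.c, s.d ^^^ s.b, s.e ^^^ s.c, s.f⟩
  | .f0f1, s => mapC (gw 2 8) ⟨s.a, s.b ^^^ s.c, s.c, s.d ^^^ s.e, s.e, s.f ^^^ 8⟩
  | .f1f0, s => mapC (gw 3 4) ⟨s.a, s.b, s.c ^^^ s.b, s.d, s.e ^^^ s.d, s.f ^^^ 4⟩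
  | .f0e0, s => ⟨s.a, s.b, s.c, s.d ^^^ s.a, s.e, s.f ^^^ s.c⟩
  | .f0e1, s => ⟨s.a, s.b ^^^ s.a, s.c, s.d, s.e, s.f ^^^ s.e⟩
  | .f1e0, s => ⟨s.a, s.b, s.c, s.d, s.e ^^^ s.a, s.f ^^^ s.b⟩
  | .f1e1, s => ⟨s.a, s.b, s.c ^^^ s.a, s.d, s.e, s.f ^^^ s.d⟩
  | .e0F0, s => mapC (gw 0 4) s
  | .e0F1, s => mapC (gw 0 8) s
  | .e1F0, s => mapC (gw 1 4) s
  | .e1F1, s => mapC (gw 1 8) s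

def key5 (s : Code) : ℕ :=
  (((s.a * 16 + s.d) * 16 + s.e) * 16 + s.b) * 16 + s.c

def key (s : Code) : ℕ := key5 s * 16 + s.f

def actW (w : List Gen) (s : Code) : Code := w.foldl (fun t g => act g t) s

def reps : List Code :=
  [⟨0,0,0,0,0,0⟩, ⟨0,0,0,0,0,1⟩, ⟨0,0,0,0,0,12⟩, ⟨0,0,2,0,0,0⟩, ⟨0,0,2,0,0,8⟩, ⟨0,0,2,0,0,12⟩,
   ⟨0,0,4,0,0,0⟩, ⟨0,0,4,0,0,2⟩, ⟨0,0,4,0,0,8⟩, ⟨0,0,8,0,0,0⟩, ⟨0,0,8,0,0,2⟩, ⟨0,0,8,0,0,4⟩,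
   ⟨0,0,8,0,4,0⟩, ⟨0,2,4,0,0,0⟩, ⟨0,2,4,0,0,8⟩, ⟨0,2,8,0,0,0⟩, ⟨0,2,8,0,0,4⟩, ⟨0,4,0,0,4,0⟩,
   ⟨0,4,0,0,4,8⟩, ⟨0,4,0,0,8,0⟩, ⟨0,4,4,0,8,0⟩, ⟨0,4,8,0,0,0⟩, ⟨0,4,8,0,0,2⟩, ⟨0,4,8,0,4,0⟩,
   ⟨0,4,12,0,0,0⟩, ⟨0,4,12,0,0,2⟩, ⟨0,8,0,0,4,0⟩, ⟨0,8,4,0,8,0⟩, ⟨0,8,4,4,12,0⟩,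
   ⟨0,8,8,0,4,0⟩, ⟨0,8,12,0,0,0⟩, ⟨0,8,12,0,0,2⟩, ⟨0,8,12,4,8,0⟩, ⟨4,0,0,0,0,0⟩,
   ⟨4,0,0,0,0,8⟩, ⟨4,0,0,0,0,12⟩, ⟨4,0,8,0,0,0⟩, ⟨4,0,8,0,0,8⟩, ⟨4,0,8,0,0,12⟩,
   ⟨4,8,0,0,0,0⟩, ⟨4,8,0,0,0,4⟩, ⟨4,8,0,0,0,8⟩, ⟨4,8,0,0,0,12⟩, ⟨4,8,0,0,8,0⟩,
   ⟨4,8,0,0,8,4⟩, ⟨4,8,0,0,8,8⟩]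

def words1 : List (List Gen) :=
  [[.f0f1], [.f1e0], [.f0e1], [.e0e1], [.f1e1], [.f0e0], [.f1f0], [.e0F1], [.e1F1], [.e0F0],
   [.e1F0], [.e1e0]]

def words2 : List (List Gen) :=
  [[.e0e1, .e1e0], [.f1f0, .f0f1], [.f1f0, .f0e1], [.e1e0, .f0f1], [.e1e0, .e0e1],
   [.f0f1, .f1f0], [.f1f0, .f1e1], [.f0e1, .f1e0], [.f1f0, .f0f1, .e1F0],
   [.e0e1, .e1e0, .f0f1], [.e0e1, .e1e0, .f1f0, .f0f1], [.e0e1, .f1f0, .f0e1, .f1e0]]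

def lower (s : Code) (w : List Gen) : Bool := (key (actW w s)).blt (key s)

def lower5 (s : Code) (w : List Gen) : Bool := (key5 (actW w s)).blt (key5 s)

def asB (s : Code) (i j k : ℕ) : Bool :=
  (phi s (phi s i j &&& 3) k).beq (phi s i (phi s j k &&& 3))

def bas : List ℕ := [1, 2, 4, 8]

def validB (l : List ℕ) (s : Code) : Bool :=
  l.all fun i => l.all fun j => l.all fun k => asB s i j k

def isRep (s : Code) : Bool := reps.any fun r => (key r).beq (key s)

def good (s : Code) : Bool :=
  words1.any (lower s) || isRep s || words2.any (lower s) || !(validB bas s)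

def allLt (n : ℕ) (p : ℕ → Bool) : Bool := Nat.rec true (fun k ih => p k && ih) n

def subA (a : ℕ) : Bool := (cd (a.testBit 1) a).beq 0 && (cd (a.testBit 0) a).beq 0

def subB (a b d : ℕ) : Bool :=
  (cd (b.testBit 1) a).beq 0 && (cd (d.testBit 0) a).beq 0 &&
  (cd (b.testBit 0) b ^^^ cd (b.testBit 1) d).beq 0 &&
  (cd (d.testBit 0) b ^^^ cd (d.testBit 1) d).beq 0

def bigCheck : Bool :=
  allLt 16 fun a => !(subA a) ||
    allLt 16 fun b => allLt 16 fun d => !(subB a b d) ||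
      allLt 16 fun c => allLt 16 fun e => !(subB a c e) ||
        words1.any (lower5 ⟨a,b,c,d,e,0⟩) || words2.any (lower5 ⟨a,b,c,d,e,0⟩) ||
        allLt 16 fun f => good ⟨a,b,c,d,e,f⟩

/-- the invariant of a code -/
def row (s : Code) (x : ℕ) (y : ℕ) : ℕ :=
  cd ((phi s x y).beq 0) 1 + cd ((phi s x y).beq ((x ^^^ y) &&& 12)) 2

def sumLt (n : ℕ) (p : ℕ → ℕ) : ℕ := Nat.rec 0 (fun k ih => ih + p k) n

def invC (s : Code) : ℕ :=
  sumLt 16 fun x => (sumLt 16 (row s x) + cd ((x &&& 12).beq 0) 1) ^ 2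

def invList : List ℕ := reps.map invC

abbrev A := ZMod 2 × ZMod 2 × ZMod 4 × ZMod 4

/-! ### xor-bilinear maps -/

theorem cd_xor (p q : Bool) (w : ℕ) : cd (p ^^ q) w = cd p w ^^^ cd q w := by
  cases p <;> cases q <;> simp [cd]

theorem cd_xor' (p : Bool) (v w : ℕ) : cd p (v ^^^ w) = cd p v ^^^ cd p w := by
  cases p <;> simp [cd]

theorem cd_cd (p q : Bool) (w : ℕ) : cd p (cd q w) = cd q (cd p w) := by
  cases p <;> cases q <;> simp [cd]

theorem cd_lt {p : Bool} {w : ℕ} (h : w < 2 ^ 4) : cd p w < 2 ^ 4 := by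
  cases p <;> simp [cd] <;> omega

theorem phi_xor_left (s : Code) (x y z : ℕ) :
    phi s (x ^^^ y) z = phi s x z ^^^ phi s y z := by
  simp only [phi, Nat.testBit_xor, cd_xor]
  ac_rfl

theorem phi_comm (s : Code) (x y : ℕ) : phi s x y = phi s y x := by
  simp only [phi, cd_xor', cd_cd (y.testBit _) (x.testBit _)]
  ac_rfl

structure Wf (s : Code) : Prop where
  a : s.a < 2 ^ 4
  b : s.b < 2 ^ 4
  c : s.c < 2 ^ 4
  d : s.d < 2 ^ 4
  e : s.e < 2 ^ 4
  f : s.f < 2 ^ 4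

theorem phi_lt {s : Code} (h : Wf s) (x y : ℕ) : phi s x y < 2 ^ 4 := by
  obtain ⟨h1, h2, h3, h4, h5, h6⟩ := h
  unfold phi
  repeat' first
    | assumption
    | exact (by norm_num : 4 < 2 ^ 4)
    | exact (by norm_num : 8 < 2 ^ 4)
    | apply Nat.xor_lt_two_pow
    | apply cd_lt

/-! ### The model group -/

def c1 (k : ℕ) (x : ZMod 2) : ℕ := cd (x == 1) k
def c2 (k : ℕ) (x : ZMod 4) : ℕ := cd (x == 1 || x == 3) k

theorem c1_add (k : ℕ) (x y : ZMod 2) : c1 k (x + y) = c1 k x ^^^ c1 k y := by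
  rw [c1, c1, c1, ← cd_xor]; congr 1; revert x y; decide

theorem c2_add (k : ℕ) (x y : ZMod 4) : c2 k (x + y) = c2 k x ^^^ c2 k y := by
  rw [c2, c2, c2, ← cd_xor]; congr 1; revert x y; decide

def q (x : A) : ℕ := c1 1 x.1 ^^^ c1 2 x.2.1 ^^^ c2 4 x.2.2.1 ^^^ c2 8 x.2.2.2

theorem q_add (x y : A) : q (x + y) = q x ^^^ q y := by
  simp only [q, Prod.fst_add, Prod.snd_add, c1_add, c2_add]
  ac_rfl

def i1 (p : Bool) : ZMod 2 := cond p 1 0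
def i2 (p : Bool) : ZMod 4 := cond p 2 0

def iota (w : ℕ) : A := (i1 (w.testBit 0), i1 (w.testBit 1), i2 (w.testBit 2), i2 (w.testBit 3))

theorem i1_xor (p q : Bool) : i1 (p ^^ q) = i1 p + i1 q := by revert p q; decide
theorem i2_xor (p q : Bool) : i2 (p ^^ q) = i2 p + i2 q := by revert p q; decide

theorem iota_xor (v w : ℕ) : iota (v ^^^ w) = iota v + iota w := by
  simp only [iota, Nat.testBit_xor, i1_xor, i2_xor, Prod.mk_add_mk]

theorem iota_inj : ∀ v < 16, ∀ w < 16, iota v = iota w → v = w := by decide +kernel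

theorem q_iota : ∀ w < 16, q (iota w) = w &&& 3 := by decide +kernel

theorem add_self (x : A) : x + x = iota (q x &&& 12) := by revert x; decide +kernel

theorem iota_surj : ∀ x : A, x + x = 0 → ∃ w, w < 16 ∧ x = iota w := by decide +kernel

theorem q_lt : ∀ x : A, q x < 16 := by decide +kernel

def m (s : Code) (x y : A) : A := iota (phi s (q x) (q y))

theorem m_comm (s : Code) (x y : A) : m s x y = m s y x := by rw [m, phi_comm]; rfl
theorem m_add_left (s : Code) (x y z : A) : m s (x + y) z = m s x z + m s y z := by
  rw [m, q_add, phi_xor_left, iota_xor]; rfl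
theorem m_add_right (s : Code) (x y z : A) : m s x (y + z) = m s x y + m s x z := by
  rw [m_comm, m_add_left, m_comm, m_comm s z]

def E0 : A := (1, 0, 0, 0)
def E1 : A := (0, 1, 0, 0)
def E2 : A := (0, 0, 1, 0)
def E3 : A := (0, 0, 0, 1)

theorem decomp : ∀ x : A, x = x.1.val • E0 + x.2.1.val • E1 + x.2.2.1.val • E2 +
    x.2.2.2.val • E3 := by decide +kernel

/-- additive maps agreeing on the generators -/
theorem ext_fun (f g : A → A) (hf : ∀ x y, f (x + y) = f x + f y)
    (hg : ∀ x y, g (x + y) = g x + g y) (h0 : f E0 = g E0) (h1 : f E1 = g E1) (h2 : f E2 = g E2)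
    (h3 : f E3 = g E3) (x : A) : f x = g x := by
  let f' : A →+ A := AddMonoidHom.mk' f hf
  let g' : A →+ A := AddMonoidHom.mk' g hg
  change f' x = g' x
  have h0 : f' E0 = g' E0 := h0
  have h1 : f' E1 = g' E1 := h1
  have h2 : f' E2 = g' E2 := h2
  have h3 : f' E3 = g' E3 := h3
  rw [decomp x]
  simp only [map_add, map_nsmul, h0, h1, h2, h3]

def Ebas : List A := [E0, E1, E2, E3]

theorem ext_list (f g : A → A) (hf : ∀ x y, f (x + y) = f x + f y)
    (hg : ∀ x y, g (x + y) = g x + g y) (h : ∀ E ∈ Ebas, f E = g E) (x : A) : f x = g x :=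
  ext_fun f g hf hg (h _ (by simp [Ebas])) (h _ (by simp [Ebas])) (h _ (by simp [Ebas]))
    (h _ (by simp [Ebas])) x

theorem q0 : q E0 = 1 := by decide
theorem q1 : q E1 = 2 := by decide
theorem q2 : q E2 = 4 := by decide
theorem q3 : q E3 = 8 := by decide

theorem q_Ebas : Ebas.map q = bas := by decide

/-- associativity -/
def Valid (s : Code) : Prop := ∀ x y z, m s (m s x y) z = m s x (m s y z)

theorem mm_left {s : Code} (h : Wf s) (x y z : A) :
    m s (m s x y) z = iota (phi s (phi s (q x) (q y) &&& 3) (q z)) := by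
  rw [m, m, q_iota _ (phi_lt h _ _)]

theorem mm_right {s : Code} (h : Wf s) (x y z : A) :
    m s x (m s y z) = iota (phi s (q x) (phi s (q y) (q z) &&& 3)) := by
  rw [m, m, q_iota _ (phi_lt h _ _)]

theorem asB_of_valid {s : Code} (h : Wf s) (hv : Valid s) (x y z : A) :
    phi s (phi s (q x) (q y) &&& 3) (q z) = phi s (q x) (phi s (q y) (q z) &&& 3) := by
  have := hv x y z
  rw [mm_left h, mm_right h] at this
  exact iota_inj _ (phi_lt h _ _) _ (phi_lt h _ _) this

theorem validB_of_valid {s : Code} (h : Wf s) (hv : Valid s) : validB bas s = true := by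
  simp only [validB, ← q_Ebas, List.all_eq_true, List.mem_map, forall_exists_index, and_imp,
    forall_apply_eq_imp_iff₂]
  intro x _ y _ z _
  simp only [asB, Nat.beq_eq]
  exact asB_of_valid h hv x y z

theorem valid_of_validB {s : Code} (h : Wf s) (hv : validB bas s = true) : Valid s := by
  simp only [validB, ← q_Ebas, List.all_eq_true, List.mem_map, forall_exists_index, and_imp,
    forall_apply_eq_imp_iff₂, asB, Nat.beq_eq] at hv
  have key : ∀ x ∈ Ebas, ∀ y ∈ Ebas, ∀ z ∈ Ebas, m s (m s x y) z = m s x (m s y z) := by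
    intro x hx y hy z hz
    rw [mm_left h, mm_right h, hv x hx y hy z hz]
  have k2 : ∀ x ∈ Ebas, ∀ y ∈ Ebas, ∀ z, m s (m s x y) z = m s x (m s y z) := by
    intro x hx y hy
    refine ext_list _ _ ?_ ?_ (key x hx y hy) <;> intro u v <;> simp only [m_add_right]
  have k3 : ∀ x ∈ Ebas, ∀ y z, m s (m s x y) z = m s x (m s y z) := by
    intro x hx y z
    refine ext_list (fun y => m s (m s x y) z) (fun y => m s x (m s y z)) ?_ ?_
      (fun y hy => k2 x hx y hy z) y <;> intro u v <;> simp only [m_add_right, m_add_left]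
  intro x y z
  refine ext_list (fun x => m s (m s x y) z) (fun x => m s x (m s y z)) ?_ ?_
      (fun x hx => k3 x hx y z) x <;> intro u v <;> simp only [m_add_left]

/-! ### Equivalence of codes -/

def R (s t : Code) : Prop := ∃ g : A ≃+ A, ∀ x y, g (m s x y) = m t (g x) (g y)

theorem R.refl (s : Code) : R s s := ⟨AddEquiv.refl _, fun _ _ => rfl⟩

theorem R.trans {s t u : Code} : R s t → R t u → R s u := by
  rintro ⟨g, hg⟩ ⟨h, hh⟩
  exact ⟨g.trans h, fun x y => by simp [hg, hh]⟩

theorem R.valid {s t : Code} : R s t → Valid s → Valid t := by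
  rintro ⟨g, hg⟩ hv x y z
  obtain ⟨x, rfl⟩ := g.surjective x
  obtain ⟨y, rfl⟩ := g.surjective y
  obtain ⟨z, rfl⟩ := g.surjective z
  simp only [← hg]
  rw [hv]

theorem R_of_bas {s t : Code} (g : A ≃+ A)
    (h : ∀ x ∈ Ebas, ∀ y ∈ Ebas, g (m s x y) = m t (g x) (g y)) : R s t := by
  refine ⟨g, ?_⟩
  have k2 : ∀ x ∈ Ebas, ∀ y, g (m s x y) = m t (g x) (g y) := by
    intro x hx
    refine ext_list _ _ ?_ ?_ (h x hx) <;> intro u v <;> simp only [m_add_right, map_add]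
  intro x y
  refine ext_list (fun x => g (m s x y)) (fun x => m t (g x) (g y)) ?_ ?_
    (fun x hx => k2 x hx y) x <;> intro u v <;> simp only [m_add_left, map_add]

/-- main criterion for a transvection -/
theorem R_of_gen {s t : Code} (g : A ≃+ A) (gv gwf : ℕ → ℕ)
    (h0 : q (g E0) = gv 1) (h1 : q (g E1) = gv 2) (h2 : q (g E2) = gv 4) (h3 : q (g E3) = gv 8)
    (hw : ∀ w, g (iota w) = iota (gwf w))
    (h : ∀ x ∈ bas, ∀ y ∈ bas, gwf (phi s x y) = phi t (gv x) (gv y)) : R s t := by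
  have hv : ∀ x ∈ Ebas, q (g x) = gv (q x) := by
    simp [Ebas, h0, h1, h2, h3, q0, q1, q2, q3]
  have hb : ∀ x ∈ Ebas, q x ∈ bas := by
    simp [Ebas, q0, q1, q2, q3, bas]
  refine R_of_bas g fun x hx y hy => ?_
  rw [m, hw, h _ (hb x hx) _ (hb y hy), m, hv x hx, hv y hy]

/-! ### The generators -/

theorem phi_xor_right (s : Code) (x y z : ℕ) :
    phi s x (y ^^^ z) = phi s x y ^^^ phi s x z := by
  rw [phi_comm, phi_xor_left, phi_comm, phi_comm s z]

section basics
variable (s : Code) (x : ℕ)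
theorem p11 : phi s 1 1 = 0 := by simp [phi, cd, Nat.testBit]
theorem p12 : phi s 1 2 = s.a := by simp [phi, cd, Nat.testBit]
theorem p14 : phi s 1 4 = s.b := by simp [phi, cd, Nat.testBit]
theorem p18 : phi s 1 8 = s.c := by simp [phi, cd, Nat.testBit]
theorem p21 : phi s 2 1 = s.a := by simp [phi, cd, Nat.testBit]
theorem p22 : phi s 2 2 = 0 := by simp [phi, cd, Nat.testBit]
theorem p24 : phi s 2 4 = s.d := by simp [phi, cd, Nat.testBit]
theorem p28 : phi s 2 8 = s.e := by simp [phi, cd, Nat.testBit]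
theorem p41 : phi s 4 1 = s.b := by simp [phi, cd, Nat.testBit]
theorem p42 : phi s 4 2 = s.d := by simp [phi, cd, Nat.testBit]
theorem p44 : phi s 4 4 = 4 := by simp [phi, cd, Nat.testBit]
theorem p48 : phi s 4 8 = s.f := by simp [phi, cd, Nat.testBit]
theorem p81 : phi s 8 1 = s.c := by simp [phi, cd, Nat.testBit]
theorem p82 : phi s 8 2 = s.e := by simp [phi, cd, Nat.testBit]
theorem p84 : phi s 8 4 = s.f := by simp [phi, cd, Nat.testBit]
theorem p88 : phi s 8 8 = 8 := by simp [phi, cd, Nat.testBit]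
theorem l3 : phi s 3 x = phi s 1 x ^^^ phi s 2 x := phi_xor_left s 1 2 x
theorem l5 : phi s 5 x = phi s 1 x ^^^ phi s 4 x := phi_xor_left s 1 4 x
theorem l6 : phi s 6 x = phi s 2 x ^^^ phi s 4 x := phi_xor_left s 2 4 x
theorem l9 : phi s 9 x = phi s 1 x ^^^ phi s 8 x := phi_xor_left s 1 8 x
theorem l10 : phi s 10 x = phi s 2 x ^^^ phi s 8 x := phi_xor_left s 2 8 x
theorem l12 : phi s 12 x = phi s 4 x ^^^ phi s 8 x := phi_xor_left s 4 8 x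
theorem r3 : phi s x 3 = phi s x 1 ^^^ phi s x 2 := phi_xor_right s x 1 2
theorem r5 : phi s x 5 = phi s x 1 ^^^ phi s x 4 := phi_xor_right s x 1 4
theorem r6 : phi s x 6 = phi s x 2 ^^^ phi s x 4 := phi_xor_right s x 2 4
theorem r9 : phi s x 9 = phi s x 1 ^^^ phi s x 8 := phi_xor_right s x 1 8
theorem r10 : phi s x 10 = phi s x 2 ^^^ phi s x 8 := phi_xor_right s x 2 8
theorem r12 : phi s x 12 = phi s x 4 ^^^ phi s x 8 := phi_xor_right s x 4 8
end basics

theorem gw_xor (i k v w : ℕ) : gw i k (v ^^^ w) = gw i k v ^^^ gw i k w := by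
  simp only [gw, Nat.testBit_xor, cd_xor]; ac_rfl

theorem gw_zero (i k : ℕ) : gw i k 0 = 0 := by simp [gw, cd]
theorem gw_024 : gw 0 2 4 = 4 := by decide
theorem gw_028 : gw 0 2 8 = 8 := by decide
theorem gw_114 : gw 1 1 4 = 4 := by decide
theorem gw_118 : gw 1 1 8 = 8 := by decide
theorem gw_284 : gw 2 8 4 = 4 ^^^ 8 := by decide
theorem gw_288 : gw 2 8 8 = 8 := by decide
theorem gw_344 : gw 3 4 4 = 4 := by decide
theorem gw_348 : gw 3 4 8 = 4 ^^^ 8 := by decide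
theorem gw_044 : gw 0 4 4 = 4 := by decide
theorem gw_048 : gw 0 4 8 = 8 := by decide
theorem gw_084 : gw 0 8 4 = 4 := by decide
theorem gw_088 : gw 0 8 8 = 8 := by decide
theorem gw_144 : gw 1 4 4 = 4 := by decide
theorem gw_148 : gw 1 4 8 = 8 := by decide
theorem gw_184 : gw 1 8 4 = 4 := by decide
theorem gw_188 : gw 1 8 8 = 8 := by decide

def r42 (x : ZMod 4) : ZMod 2 := cond (x == 1 || x == 3) 1 0
def d24 (x : ZMod 2) : ZMod 4 := cond (x == 1) 2 0
theorem r42_add : ∀ x y, r42 (x + y) = r42 x + r42 y := by decide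
theorem d24_add : ∀ x y, d24 (x + y) = d24 x + d24 y := by decide

theorem z2 : ∀ x y : ZMod 2, x + y + y = x := by decide
theorem z4 : ∀ (x : ZMod 4) (y : ZMod 2), x + d24 y + d24 y = x := by decide

def tE0E1 : A ≃+ A where
  toFun x := (x.1, x.2.1 + x.1, x.2.2.1, x.2.2.2)
  invFun x := (x.1, x.2.1 + x.1, x.2.2.1, x.2.2.2)
  left_inv x := by simp [z2]
  right_inv x := by simp [z2]
  map_add' x y := by ext <;> (simp; try abel)

def tE1E0 : A ≃+ A where
  toFun x := (x.1 + x.2.1, x.2.1, x.2.2.1, x.2.2.2)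
  invFun x := (x.1 + x.2.1, x.2.1, x.2.2.1, x.2.2.2)
  left_inv x := by simp [z2]
  right_inv x := by simp [z2]
  map_add' x y := by ext <;> (simp; try abel)

def tF0F1 : A ≃+ A where
  toFun x := (x.1, x.2.1, x.2.2.1, x.2.2.2 + x.2.2.1)
  invFun x := (x.1, x.2.1, x.2.2.1, x.2.2.2 - x.2.2.1)
  left_inv x := by simp
  right_inv x := by simp
  map_add' x y := by ext <;> (simp; try abel)

def tF1F0 : A ≃+ A where
  toFun x := (x.1, x.2.1, x.2.2.1 + x.2.2.2, x.2.2.2)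
  invFun x := (x.1, x.2.1, x.2.2.1 - x.2.2.2, x.2.2.2)
  left_inv x := by simp
  right_inv x := by simp
  map_add' x y := by ext <;> (simp; try abel)

def tF0E0 : A ≃+ A where
  toFun x := (x.1 + r42 x.2.2.1, x.2.1, x.2.2.1, x.2.2.2)
  invFun x := (x.1 + r42 x.2.2.1, x.2.1, x.2.2.1, x.2.2.2)
  left_inv x := by simp [z2]
  right_inv x := by simp [z2]
  map_add' x y := by ext <;> simp [r42_add]; abel

def tF0E1 : A ≃+ A where
  toFun x := (x.1, x.2.1 + r42 x.2.2.1, x.2.2.1, x.2.2.2)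
  invFun x := (x.1, x.2.1 + r42 x.2.2.1, x.2.2.1, x.2.2.2)
  left_inv x := by simp [z2]
  right_inv x := by simp [z2]
  map_add' x y := by ext <;> simp [r42_add]; abel

def tF1E0 : A ≃+ A where
  toFun x := (x.1 + r42 x.2.2.2, x.2.1, x.2.2.1, x.2.2.2)
  invFun x := (x.1 + r42 x.2.2.2, x.2.1, x.2.2.1, x.2.2.2)
  left_inv x := by simp [z2]
  right_inv x := by simp [z2]
  map_add' x y := by ext <;> simp [r42_add]; abel

def tF1E1 : A ≃+ A where
  toFun x := (x.1, x.2.1 + r42 x.2.2.2, x.2.2.1, x.2.2.2)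
  invFun x := (x.1, x.2.1 + r42 x.2.2.2, x.2.2.1, x.2.2.2)
  left_inv x := by simp [z2]
  right_inv x := by simp [z2]
  map_add' x y := by ext <;> simp [r42_add]; abel

def tE0D0 : A ≃+ A where
  toFun x := (x.1, x.2.1, x.2.2.1 + d24 x.1, x.2.2.2)
  invFun x := (x.1, x.2.1, x.2.2.1 + d24 x.1, x.2.2.2)
  left_inv x := by simp [z4]
  right_inv x := by simp [z4]
  map_add' x y := by ext <;> simp [d24_add]; abel

def tE0D1 : A ≃+ A where
  toFun x := (x.1, x.2.1, x.2.2.1, x.2.2.2 + d24 x.1)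
  invFun x := (x.1, x.2.1, x.2.2.1, x.2.2.2 + d24 x.1)
  left_inv x := by simp [z4]
  right_inv x := by simp [z4]
  map_add' x y := by ext <;> simp [d24_add]; abel

def tE1D0 : A ≃+ A where
  toFun x := (x.1, x.2.1, x.2.2.1 + d24 x.2.1, x.2.2.2)
  invFun x := (x.1, x.2.1, x.2.2.1 + d24 x.2.1, x.2.2.2)
  left_inv x := by simp [z4]
  right_inv x := by simp [z4]
  map_add' x y := by ext <;> simp [d24_add]; abel

def tE1D1 : A ≃+ A where
  toFun x := (x.1, x.2.1, x.2.2.1, x.2.2.2 + d24 x.2.1)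
  invFun x := (x.1, x.2.1, x.2.2.1, x.2.2.2 + d24 x.2.1)
  left_inv x := by simp [z4]
  right_inv x := by simp [z4]
  map_add' x y := by ext <;> simp [d24_add]; abel

def aut : Gen → (A ≃+ A)
  | .e0e1 => tE0E1
  | .e1e0 => tE1E0
  | .f0f1 => tF0F1
  | .f1f0 => tF1F0
  | .f0e0 => tF0E0
  | .f0e1 => tF0E1
  | .f1e0 => tF1E0
  | .f1e1 => tF1E1
  | .e0F0 => tE0D0
  | .e0F1 => tE0D1
  | .e1F0 => tE1D0
  | .e1F1 => tE1D1

/-- action on `A / 2A` -/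
def gv : Gen → ℕ → ℕ
  | .e0e1, x => if x = 1 then 3 else x
  | .e1e0, x => if x = 2 then 3 else x
  | .f0f1, x => if x = 4 then 12 else x
  | .f1f0, x => if x = 8 then 12 else x
  | .f0e0, x => if x = 4 then 5 else x
  | .f0e1, x => if x = 4 then 6 else x
  | .f1e0, x => if x = 8 then 9 else x
  | .f1e1, x => if x = 8 then 10 else x
  | _, x => x

/-- action on `A[2]` -/
def gwG : Gen → ℕ → ℕ
  | .e0e1 => gw 0 2
  | .e1e0 => gw 1 1
  | .f0f1 => gw 2 8
  | .f1f0 => gw 3 4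
  | .e0F0 => gw 0 4
  | .e0F1 => gw 0 8
  | .e1F0 => gw 1 4
  | .e1F1 => gw 1 8
  | _ => id

theorem x48a (t : ℕ) : 12 = 4 ^^^ (t ^^^ 8) ^^^ t := by
  have : 4 ^^^ (t ^^^ 8) ^^^ t = (4 ^^^ 8) ^^^ (t ^^^ t) := by ac_rfl
  rw [this]; simp

theorem x48b (t : ℕ) : 12 = t ^^^ (t ^^^ 4 ^^^ 8) := by
  have : t ^^^ (t ^^^ 4 ^^^ 8) = (4 ^^^ 8) ^^^ (t ^^^ t) := by ac_rfl
  rw [this]; simp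

theorem tb_gw (i k w j : ℕ) :
    (gw i k w).testBit j = (w.testBit j ^^ (w.testBit i && k.testBit j)) := by
  rw [gw, Nat.testBit_xor]; cases w.testBit i <;> simp [cd]

theorem aut_iota (g : Gen) (w : ℕ) : aut g (iota w) = iota (gwG g w) := by
  have h : ∀ p0 p1 p2 p3 : Bool, ∀ v, w.testBit 0 = p0 → w.testBit 1 = p1 →
      w.testBit 2 = p2 → w.testBit 3 = p3 → v = gwG g w → aut g (iota w) = iota v := by
    intro p0 p1 p2 p3 v h0 h1 h2 h3 hv
    subst hv
    cases g <;> simp only [gwG, iota, tb_gw, h0, h1, h2, h3, id] <;> clear h0 h1 h2 h3 <;>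
      revert p0 p1 p2 p3 <;> decide
  exact h _ _ _ _ _ rfl rfl rfl rfl rfl

theorem R_act (g : Gen) (s : Code) : R s (act g s) := by
  refine R_of_gen (aut g) (gv g) (gwG g) ?_ ?_ ?_ ?_ (aut_iota g) ?_
  · cases g <;> decide
  · cases g <;> decide
  · cases g <;> decide
  · cases g <;> decide
  · cases g <;>
    simp [bas, gv, gwG, act, mapC, p11, p12, p14, p18, p21, p22, p24, p28, p41, p42, p44, p48, p81,
      p82, p84, p88, l3, l5, l6, l9, l10, l12, r3, r5, r6, r9, r10, r12, gw_xor, gw_zero,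
      gw_024, gw_028, gw_114, gw_118, gw_284, gw_288, gw_344, gw_348, gw_044, gw_048, gw_084,
      gw_088, gw_144, gw_148, gw_184, gw_188]
    · exact x48a _
    · exact x48b _

/-! ### Reduction to the representatives -/

theorem gw_lt {i k w : ℕ} (hk : k < 2 ^ 4) (hw : w < 2 ^ 4) : gw i k w < 2 ^ 4 :=
  Nat.xor_lt_two_pow hw (cd_lt hk)

theorem wf_mapC {s : Code} {h : ℕ → ℕ} (hs : Wf s) (hh : ∀ w < 2 ^ 4, h w < 2 ^ 4) :
    Wf (mapC h s) :=
  ⟨hh _ hs.a, hh _ hs.b, hh _ hs.c, hh _ hs.d, hh _ hs.e, hh _ hs.f⟩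

theorem wf_act (g : Gen) {s : Code} (hs : Wf s) : Wf (act g s) := by
  obtain ⟨h1, h2, h3, h4, h5, h6⟩ := hs
  have h4' : 4 < 2 ^ 4 := by norm_num
  have h8' : 8 < 2 ^ 4 := by norm_num
  cases g <;> simp only [act] <;>
  first
  | exact wf_mapC (by constructor <;> (first | assumption | (apply Nat.xor_lt_two_pow <;> assumption)))
      (fun w hw => gw_lt (by norm_num) hw)
  | (constructor <;> (first | assumption | (apply Nat.xor_lt_two_pow <;> assumption)))

theorem actW_spec (w : List Gen) : ∀ s : Code, Wf s → Wf (actW w s) ∧ R s (actW w s) := by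
  induction w with
  | nil => intro s hs; exact ⟨hs, R.refl s⟩
  | cons g w ih =>
    intro s hs
    obtain ⟨h1, h2⟩ := ih (act g s) (wf_act g hs)
    exact ⟨h1, (R_act g s).trans h2⟩

def Eq5 (s t : Code) : Prop := s.a = t.a ∧ s.b = t.b ∧ s.c = t.c ∧ s.d = t.d ∧ s.e = t.e

theorem eq5_act (g : Gen) {s t : Code} (h : Eq5 s t) : Eq5 (act g s) (act g t) := by
  obtain ⟨h1, h2, h3, h4, h5⟩ := h
  cases g <;> simp [Eq5, act, mapC, h1, h2, h3, h4, h5]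

theorem eq5_actW (w : List Gen) : ∀ {s t : Code}, Eq5 s t → Eq5 (actW w s) (actW w t) := by
  induction w with
  | nil => intro s t h; exact h
  | cons g w ih => intro s t h; exact ih (eq5_act g h)

theorem key5_congr {s t : Code} (h : Eq5 s t) : key5 s = key5 t := by
  obtain ⟨h1, h2, h3, h4, h5⟩ := h
  simp only [key5, h1, h2, h3, h4, h5]

theorem key_lt_of_lower5 {s t : Code} (hs : Wf s) (h : Eq5 t s) (w : List Gen)
    (hl : lower5 t w = true) : key (actW w s) < key s := by
  have h1 : key5 (actW w t) < key5 t := by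
    simpa [lower5, Nat.blt_eq] using hl
  rw [key5_congr h, key5_congr (eq5_actW w h)] at h1
  have := (actW_spec w s hs).1.f
  unfold key
  omega

theorem allLt_iff (n : ℕ) (p : ℕ → Bool) : allLt n p = true ↔ ∀ k < n, p k = true := by
  induction n with
  | zero => simp [allLt]
  | succ n ih =>
    have : allLt (n + 1) p = (p n && allLt n p) := rfl
    rw [this, Bool.and_eq_true, ih]
    constructor
    · rintro ⟨h1, h2⟩ k hk
      rcases Nat.lt_succ_iff_lt_or_eq.1 hk with h | rfl
      · exact h2 k h
      · exact h1
    · intro h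
      exact ⟨h n (by omega), fun k hk => h k (by omega)⟩

theorem bigCheck_true : bigCheck = true := by decide +kernel

theorem testBit_lt16 : ∀ w < 16, w &&& 3 = cd (w.testBit 0) 1 ^^^ cd (w.testBit 1) 2 := by
  decide

theorem phi_cd_right (s : Code) (x y : ℕ) (p : Bool) : phi s x (cd p y) = cd p (phi s x y) := by
  cases p
  · simp [cd]
    have := phi_xor_right s x 0 0
    simpa using this
  · rfl

theorem phi_zero_left (s : Code) (x : ℕ) : phi s 0 x = 0 := by
  have := phi_xor_left s 0 0 x
  simpa using this

theorem subA_of {s : Code} (h : Wf s) (hv : Valid s) : subA s.a = true := by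
  have h1 := asB_of_valid h hv E0 E0 E1
  have h2 := asB_of_valid h hv E1 E1 E0
  simp only [q0, q1, p11, p12, p21, p22, testBit_lt16 _ h.a, phi_xor_right, phi_cd_right,
    Nat.zero_and, phi_zero_left] at h1 h2
  simp [cd] at h1 h2
  simp [subA, cd]
  exact ⟨h1.symm, h2.symm⟩

theorem subB_of {s : Code} (h : Wf s) (hv : Valid s) :
    subB s.a s.b s.d = true ∧ subB s.a s.c s.e = true := by
  have h1 := asB_of_valid h hv E0 E0 E2
  have h2 := asB_of_valid h hv E1 E1 E2
  have h3 := asB_of_valid h hv E2 E2 E0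
  have h4 := asB_of_valid h hv E2 E2 E1
  have h5 := asB_of_valid h hv E0 E0 E3
  have h6 := asB_of_valid h hv E1 E1 E3
  have h7 := asB_of_valid h hv E3 E3 E0
  have h8 := asB_of_valid h hv E3 E3 E1
  have e4 : 4 &&& 3 = 0 := by decide
  have e8 : 8 &&& 3 = 0 := by decide
  have cz : ∀ p, cd p 0 = 0 := by decide
  simp only [q0, q1, q2, q3, p11, p12, p14, p18, p21, p22, p24, p28, p41, p42, p44, p81,
      p82, p88, testBit_lt16 _ h.b, testBit_lt16 _ h.c, testBit_lt16 _ h.d,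
      testBit_lt16 _ h.e, phi_xor_right, phi_cd_right, cz, Nat.zero_xor, Nat.xor_zero,
      Nat.zero_and, e4, e8, phi_zero_left] at h1 h2 h3 h4 h5 h6 h7 h8
  simp only [subB, Bool.and_eq_true, Nat.beq_eq]
  exact ⟨⟨⟨⟨h1.symm, h2.symm⟩, h3.symm⟩, h4.symm⟩, ⟨⟨⟨h5.symm, h6.symm⟩, h7.symm⟩, h8.symm⟩⟩

theorem key_inj {s t : Code} (hs : Wf s) (ht : Wf t) (h : key s = key t) : s = t := by
  obtain ⟨h1, h2, h3, h4, h5, h6⟩ := hs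
  obtain ⟨g1, g2, g3, g4, g5, g6⟩ := ht
  cases s; cases t
  simp only [key, key5] at *
  simp only [Code.mk.injEq]
  omega

def wfB (s : Code) : Bool :=
  s.a.blt 16 && s.b.blt 16 && s.c.blt 16 && s.d.blt 16 && s.e.blt 16 && s.f.blt 16

theorem wf_reps : ∀ r ∈ reps, Wf r := by
  have h : reps.all wfB = true := by decide +kernel
  intro r hr
  have := List.all_eq_true.1 h r hr
  simp only [wfB, Bool.and_eq_true, Nat.blt_eq] at this
  exact ⟨this.1.1.1.1.1, this.1.1.1.1.2, this.1.1.1.2, this.1.1.2, this.1.2, this.2⟩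

theorem step {s : Code} (hs : Wf s) (hv : Valid s) :
    s ∈ reps ∨ ∃ w, key (actW w s) < key s := by
  have hb := bigCheck_true
  simp only [bigCheck, allLt_iff, Bool.or_eq_true, Bool.not_eq_true'] at hb
  have h1 := (hb s.a hs.a).resolve_left (by simp [subA_of hs hv])
  have h2 := (h1 s.b hs.b s.d hs.d).resolve_left (by simp [(subB_of hs hv).1])
  have h3 := h2 s.c hs.c s.e hs.e
  have he : Eq5 ⟨s.a, s.b, s.c, s.d, s.e, 0⟩ s := ⟨rfl, rfl, rfl, rfl, rfl⟩
  rcases h3 with ((h | h) | h) | h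
  · simp [(subB_of hs hv).2] at h
  · obtain ⟨w, -, hw⟩ := List.any_eq_true.1 h
    exact Or.inr ⟨w, key_lt_of_lower5 hs he w hw⟩
  · obtain ⟨w, -, hw⟩ := List.any_eq_true.1 h
    exact Or.inr ⟨w, key_lt_of_lower5 hs he w hw⟩
  · have h4 := h s.f hs.f
    simp only [good, Bool.or_eq_true, validB_of_valid hs hv] at h4
    rcases h4 with ((h | h) | h) | h
    · obtain ⟨w, -, hw⟩ := List.any_eq_true.1 h
      exact Or.inr ⟨w, by simpa [lower, Nat.blt_eq] using hw⟩
    · obtain ⟨r, hr, hrs⟩ := List.any_eq_true.1 h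
      left
      have : r = s := key_inj (wf_reps r hr) hs (by simpa using hrs)
      exact this ▸ hr
    · obtain ⟨w, -, hw⟩ := List.any_eq_true.1 h
      exact Or.inr ⟨w, by simpa [lower, Nat.blt_eq] using hw⟩
    · simp at h

theorem reduce (n : ℕ) : ∀ s : Code, key s < n → Wf s → Valid s → ∃ r ∈ reps, R s r := by
  induction n with
  | zero => intro s h; omega
  | succ n ih =>
    intro s hn hs hv
    rcases step hs hv with h | ⟨w, hw⟩
    · exact ⟨s, h, R.refl s⟩
    · obtain ⟨h1, h2⟩ := actW_spec w s hs
      obtain ⟨r, hr, hR⟩ := ih _ (by omega) h1 (h2.valid hv)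
      exact ⟨r, hr, h2.trans hR⟩

theorem valid_reps : ∀ r ∈ reps, Valid r := by
  have h : reps.all (validB bas) = true := by decide +kernel
  intro r hr
  exact valid_of_validB (wf_reps r hr) (List.all_eq_true.1 h r hr)

/-! ### Braces -/

theorem xor_pairs (a b c d e f x y : ℕ) : (a ^^^ b ^^^ c) ^^^ (a ^^^ d ^^^ e) ^^^
    (b ^^^ d ^^^ x ^^^ f) ^^^ (c ^^^ e ^^^ f ^^^ y) = x ^^^ y := by
  have : (a ^^^ b ^^^ c) ^^^ (a ^^^ d ^^^ e) ^^^
    (b ^^^ d ^^^ x ^^^ f) ^^^ (c ^^^ e ^^^ f ^^^ y) = (a ^^^ a) ^^^ (b ^^^ b) ^^^ (c ^^^ c) ^^^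
    (d ^^^ d) ^^^ (e ^^^ e) ^^^ (f ^^^ f) ^^^ (x ^^^ y) := by ac_rfl
  rw [this]; simp

theorem cd_same (p : Bool) (w : ℕ) : cd p (cd p w) = cd p w := by cases p <;> rfl

theorem m_self (s : Code) (x : A) : m s x x = x + x := by
  rw [add_self, m]
  congr 1
  have h : ∀ v < 16, phi s v v = v &&& 12 := by
    intro v hv
    have e : v &&& 12 = cd (v.testBit 2) 4 ^^^ cd (v.testBit 3) 8 := by
      revert v; decide
    rw [e]
    simp only [phi, cd_xor', cd_same, cd_cd (v.testBit 1) (v.testBit 0),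
      cd_cd (v.testBit 2) (v.testBit 0), cd_cd (v.testBit 3) (v.testBit 0),
      cd_cd (v.testBit 2) (v.testBit 1), cd_cd (v.testBit 3) (v.testBit 1),
      cd_cd (v.testBit 3) (v.testBit 2)]
    exact xor_pairs _ _ _ _ _ _ _ _
  exact h _ (q_lt x)

theorem cd_beq (u v k : ℕ) : cd (u.beq v) k = if u = v then k else 0 := by
  by_cases h : u = v
  · have h2 : Nat.beq u v = true := by rw [Nat.beq_eq]; exact h
    rw [if_pos h, h2]; rfl
  · rw [if_neg h]
    have : Nat.beq u v = false := by
      simpa [Bool.eq_false_iff] using h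
    rw [this]; rfl

theorem four (x : A) : x + x + (x + x) = 0 := by revert x; decide +kernel

theorem m_zero_right (s : Code) (x : A) : m s x 0 = 0 := by
  have := m_add_right s x 0 0
  simpa using this

theorem m_zero_left (s : Code) (x : A) : m s 0 x = 0 := by
  rw [m_comm, m_zero_right]

def br (s : Code) (hv : Valid s) : LeftBrace A where
  add x y := x + y
  zero := 0
  neg x := -x
  mul x y := x + y + m s x y
  one := 0
  inv x := x
  add_assoc := add_assoc
  add_comm := add_comm
  zero_add := zero_add
  neg_add_cancel := neg_add_cancel
  mul_assoc x y z := by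
    simp only [m_add_left, m_add_right, hv x y z]
    abel
  one_mul x := by simp [m_zero_left]
  mul_one x := by simp [m_zero_right]
  inv_mul_cancel x := by rw [m_self, four]
  brace x y z := by
    rw [m_add_right]; abel

theorem iso_of_R {s t : Code} (hs : Valid s) (ht : Valid t) (h : R s t) :
    (br s hs).Iso (br t ht) := by
  obtain ⟨g, hg⟩ := h
  refine ⟨g.toEquiv, fun x y => map_add g x y, fun x y => ?_⟩
  change g (x + y + m s x y) = g x + g y + m t (g x) (g y)
  rw [map_add, map_add, hg]

theorem Iso.symm {B C : Type} {L : LeftBrace B} {M : LeftBrace C} (h : L.Iso M) : M.Iso L := by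
  obtain ⟨e, h1, h2⟩ := h
  refine ⟨e.symm, fun x y => ?_, fun x y => ?_⟩
  · rw [Equiv.symm_apply_eq, h1]; simp
  · rw [Equiv.symm_apply_eq, h2]; simp

theorem Iso.trans {B C D : Type} {L : LeftBrace B} {M : LeftBrace C} {N : LeftBrace D}
    (h : L.Iso M) (h' : M.Iso N) : L.Iso N := by
  obtain ⟨e, h1, h2⟩ := h
  obtain ⟨f, g1, g2⟩ := h'
  exact ⟨e.trans f, fun x y => by simp [h1, g1], fun x y => by simp [h2, g2]⟩

/-- transport of a brace along a bijection -/
def tr {B C : Type} (e : B ≃ C) (L : LeftBrace B) : LeftBrace C where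
  add x y := e (L.add (e.symm x) (e.symm y))
  zero := e L.zero
  neg x := e (L.neg (e.symm x))
  mul x y := e (L.mul (e.symm x) (e.symm y))
  one := e L.one
  inv x := e (L.inv (e.symm x))
  add_assoc x y z := by simp [L.add_assoc]
  add_comm x y := by rw [L.add_comm]
  zero_add x := by simp [L.zero_add]
  neg_add_cancel x := by simp [L.neg_add_cancel]
  mul_assoc x y z := by simp [L.mul_assoc]
  one_mul x := by simp [L.one_mul]
  mul_one x := by simp [L.mul_one]
  inv_mul_cancel x := by simp [L.inv_mul_cancel]
  brace x y z := by simp [L.brace]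

theorem iso_tr {B C : Type} (e : B ≃ C) (L : LeftBrace B) : L.Iso (tr e L) :=
  ⟨e, fun x y => by simp [tr], fun x y => by simp [tr]⟩

/-! ### The invariant -/

def wt {B : Type} [DecidableEq B] (L : LeftBrace B) (x y : B) : ℕ :=
  (if L.mul x y = L.add x y then 1 else 0) +
  (if L.mul x y = L.add (L.add x y) (L.add (L.add x y) (L.add x y)) then 2 else 0)

def invL {B : Type} [DecidableEq B] [Fintype B] (L : LeftBrace B) : ℕ :=
  ∑ x, (∑ y, wt L x y + (if L.add (L.add x x) x = x then 4 else 0)) ^ 2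

theorem invL_iso {B C : Type} [DecidableEq B] [Fintype B] [DecidableEq C] [Fintype C]
    {L : LeftBrace B} {M : LeftBrace C} (h : L.Iso M) : invL L = invL M := by
  obtain ⟨e, h1, h2⟩ := h
  unfold invL
  rw [← Equiv.sum_comp e]
  refine Finset.sum_congr rfl fun x _ => ?_
  congr 1
  congr 1
  · rw [← Equiv.sum_comp e]
    refine Finset.sum_congr rfl fun y _ => ?_
    simp only [wt, ← h1, ← h2, e.injective.eq_iff]
  · simp only [← h1, e.injective.eq_iff]

theorem sumLt_eq (n : ℕ) (p : ℕ → ℕ) : sumLt n p = ∑ k ∈ Finset.range n, p k := by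
  induction n with
  | zero => rfl
  | succ n ih =>
    rw [Finset.sum_range_succ, ← ih]; rfl

theorem sum_q (F : ℕ → ℕ) : ∑ x : A, F (q x) = 4 * sumLt 16 F := by
  have h1 : (Finset.univ : Finset A).image q = Finset.range 16 := by decide +kernel
  have h2 : ∀ b < 16, (Finset.univ.filter fun x : A => q x = b).card = 4 := by decide +kernel
  rw [Finset.sum_comp F q, h1, sumLt_eq, Finset.mul_sum]
  refine Finset.sum_congr rfl fun b hb => ?_
  rw [h2 b (Finset.mem_range.1 hb), smul_eq_mul]

theorem and12_lt : ∀ v < 16, v &&& 12 < 16 := by decide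

theorem wt_br (s : Code) (hs : Wf s) (hv : Valid s) (x y : A) :
    wt (br s hv) x y = row s (q x) (q y) := by
  have e1 : ((br s hv).mul x y = (br s hv).add x y) ↔ phi s (q x) (q y) = 0 := by
    change x + y + m s x y = x + y ↔ _
    rw [add_eq_left, m]
    constructor
    · intro h; exact iota_inj _ (phi_lt hs _ _) 0 (by norm_num) (h.trans (by decide))
    · intro h; rw [h]; decide
  have e2 : ((br s hv).mul x y = (br s hv).add ((br s hv).add x y)
      ((br s hv).add ((br s hv).add x y) ((br s hv).add x y))) ↔
      phi s (q x) (q y) = (q x ^^^ q y) &&& 12 := by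
    change x + y + m s x y = x + y + (x + y + (x + y)) ↔ _
    rw [add_right_inj, m, add_self, q_add]
    constructor
    · intro h
      exact iota_inj _ (phi_lt hs _ _) _ (and12_lt _ (by rw [← q_add]; exact q_lt _)) h
    · intro h; rw [h]
  simp only [wt, row, e1, e2, cd_beq]

theorem invL_br (s : Code) (hs : Wf s) (hv : Valid s) : invL (br s hv) = 64 * invC s := by
  have h : ∀ x : A, (∑ y, wt (br s hv) x y +
      (if (br s hv).add ((br s hv).add x x) x = x then 4 else 0)) ^ 2 =
      16 * (sumLt 16 (row s (q x)) + cd ((q x &&& 12).beq 0) 1) ^ 2 := by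
    intro x
    simp only [wt_br s hs hv]
    rw [sum_q (row s (q x))]
    have e : ((br s hv).add ((br s hv).add x x) x = x) ↔ q x &&& 12 = 0 := by
      change x + x + x = x ↔ _
      revert x; decide +kernel
    simp only [e]
    have : (if q x &&& 12 = 0 then 4 else 0) = 4 * cd ((q x &&& 12).beq 0) 1 := by
      rw [cd_beq]; split_ifs <;> rfl
    rw [this]; ring
  unfold invL
  simp only [h]
  rw [← Finset.mul_sum,
    sum_q (fun v => (sumLt 16 (row s v) + cd ((v &&& 12).beq 0) 1) ^ 2)]
  unfold invC
  ring

theorem inv_nodup : (reps.map invC).Nodup := by decide +kernel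

/-! ### Extraction of a code from a brace -/

theorem extract_m (n : A → A → A) (hc : ∀ x y, n x y = n y x)
    (ha : ∀ x y z, n x (y + z) = n x y + n x z) (hs : ∀ x, n x x = x + x)
    (has : ∀ x y z, n (n x y) z = n x (n y z)) :
    ∃ s, Wf s ∧ Valid s ∧ ∀ x y, n x y = m s x y := by
  have ha' : ∀ x y z, n (x + y) z = n x z + n y z := fun x y z => by
    rw [hc, ha, hc, hc z]
  have h2 : ∀ x y, n x y + n x y = 0 := by
    intro x y
    have h := hs (x + y)
    rw [ha, ha', ha', hs, hs, hc y x] at h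
    have : x + y + (x + y) + (n x y + n x y) = x + y + (x + y) + 0 := by
      rw [add_zero]
      calc _ = x + x + n x y + (n x y + (y + y)) := by abel
        _ = _ := h
    exact add_left_cancel this
  obtain ⟨a, a1, a2⟩ := iota_surj _ (h2 E0 E1)
  obtain ⟨b, b1, b2⟩ := iota_surj _ (h2 E0 E2)
  obtain ⟨c, c1, c2⟩ := iota_surj _ (h2 E0 E3)
  obtain ⟨d, d1, d2⟩ := iota_surj _ (h2 E1 E2)
  obtain ⟨e, e1, e2⟩ := iota_surj _ (h2 E1 E3)
  obtain ⟨f, f1, f2⟩ := iota_surj _ (h2 E2 E3)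
  have i0 : E0 + E0 = iota 0 := by decide
  have i1 : E1 + E1 = iota 0 := by decide
  have i2 : E2 + E2 = iota 4 := by decide
  have i3 : E3 + E3 = iota 8 := by decide
  have hm : ∀ x y, n x y = m ⟨a, b, c, d, e, f⟩ x y := by
    have k1 : ∀ x ∈ Ebas, ∀ y ∈ Ebas, n x y = m ⟨a, b, c, d, e, f⟩ x y := by
      simp only [Ebas, List.mem_cons, List.not_mem_nil, or_false, forall_eq_or_imp, forall_eq, m,
        q0, q1, q2, q3, p11, p12, p14, p18, p21, p22, p24, p28, p41, p42, p44, p48, p81,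
        p82, p84, p88, hs, hc E1 E0, hc E2 E0, hc E2 E1, hc E3 E0, hc E3 E1, hc E3 E2,
        a2, b2, c2, d2, e2, f2, i0, i1, i2, i3, and_self]
    have k2 : ∀ x ∈ Ebas, ∀ y, n x y = m ⟨a, b, c, d, e, f⟩ x y := by
      intro x hx
      exact ext_list _ _ (ha x) (m_add_right _ x) (k1 x hx)
    intro x y
    exact ext_list (fun x => n x y) (fun x => m _ x y) (fun u v => ha' u v y)
      (fun u v => m_add_left _ u v y) (fun x hx => k2 x hx y) x
  refine ⟨⟨a, b, c, d, e, f⟩, ⟨a1, b1, c1, d1, e1, f1⟩, ?_, hm⟩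
  intro x y z
  simp only [← hm]
  exact has x y z

theorem negneg : ∀ x : A, 0 - x - x = x + x := by decide +kernel

abbrev E := ZMod 2 × ZMod 2 × ZMod 2 × ZMod 2 × ZMod 2 × ZMod 2

theorem extract {B : Type} (L : LeftBrace B) (h1 : L.AddIso A) (h2 : L.MulIso E) :
    ∃ s, ∃ hv : Valid s, Wf s ∧ L.Iso (br s hv) := by
  obtain ⟨e, he⟩ := h1
  obtain ⟨f, hf⟩ := h2
  have hone : f L.one = 0 := by
    have := hf L.one L.one
    rw [L.one_mul] at this
    exact left_eq_add.1 this
  have hE : ∀ x : E, x + x = 0 := by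
    intro x
    have : ∀ y : ZMod 2, y + y = 0 := by decide
    ext <;> simp [this]
  have hsq : ∀ x, L.mul x x = L.one := fun x => f.injective (by rw [hf, hone, hE])
  have hcomm : ∀ x y, L.mul x y = L.mul y x := fun x y => f.injective (by rw [hf, hf, add_comm])
  have hzero : e L.zero = 0 := by
    have := he L.zero L.zero
    rw [L.zero_add] at this
    exact left_eq_add.1 this
  have hneg : ∀ x, e (L.neg x) = - e x := by
    intro x
    have := he (L.neg x) x
    rw [L.neg_add_cancel, hzero] at this
    exact eq_neg_of_add_eq_zero_left this.symm
  let M : A → A → A := fun x y => e (L.mul (e.symm x) (e.symm y))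
  have eM : ∀ x y, e (L.mul x y) = M (e x) (e y) := fun x y => by simp [M]
  have esa : ∀ x y, e.symm (x + y) = L.add (e.symm x) (e.symm y) := by
    intro x y; rw [Equiv.symm_apply_eq, he]; simp
  have Mc : ∀ x y, M x y = M y x := fun x y => by simp only [M]; rw [hcomm]
  have Mb : ∀ x y z, M x (y + z) = M x y - x + M x z := by
    intro x y z
    simp only [M, esa, L.brace, he, hneg, Equiv.apply_symm_apply, sub_eq_add_neg]
  have Ma : ∀ x y z, M (M x y) z = M x (M y z) := by
    intro x y z
    simp only [M, Equiv.symm_apply_apply, L.mul_assoc]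
  have M0 : ∀ x, M x 0 = x := by
    intro x
    have := Mb x 0 0
    rw [add_zero] at this
    have h : M x 0 - x = 0 := by
      have h' : M x 0 = (M x 0 - x) + M x 0 := this
      exact right_eq_add.1 h'
    exact sub_eq_zero.1 h
  have h10 : e L.one = 0 := by
    have h := M0 (e L.one)
    rw [← h, ← hzero, ← eM, L.one_mul]
  have Ms : ∀ x, M x x = 0 := fun x => by simp only [M]; rw [hsq, h10]
  have na : ∀ x y z, M x (y + z) - x - (y + z) = (M x y - x - y) + (M x z - x - z) := by
    intro x y z; rw [Mb]; abel
  have na' : ∀ x y z, M (y + z) x - (y + z) - x = (M y x - y - x) + (M z x - z - x) := by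
    intro x y z; rw [Mc, Mb, Mc x y, Mc x z]; abel
  obtain ⟨s, hs, hv, hm⟩ := extract_m (fun x y => M x y - x - y)
    (fun x y => by simp only [Mc x y]; abel) na
    (fun x => by
      simp only [Ms]
      exact negneg x)
    (fun x y z => by
      have h := Ma x y z
      have e1 : M x y = (M x y - x - y) + (x + y) := by abel
      have e2 : M y z = (M y z - y - z) + (y + z) := by abel
      have l := na' z (M x y - x - y) (x + y)
      rw [← e1, na' z x y] at l
      have r := na x (M y z - y - z) (y + z)
      rw [← e2, na x y z] at r
      have l' : M (M x y - x - y) z - (M x y - x - y) - z =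
        (M (M x y) z - M x y - z) - ((M x z - x - z) + (M y z - y - z)) := by rw [l]; abel
      have r' : M x (M y z - y - z) - x - (M y z - y - z) =
        (M x (M y z) - x - M y z) - ((M x y - x - y) + (M x z - x - z)) := by rw [r]; abel
      simp only [l', r', h]
      abel)
  refine ⟨s, hv, hs, e, he, fun x y => ?_⟩
  change e (L.mul x y) = e x + e y + m s (e x) (e y)
  rw [eM, ← hm]
  abel

/-! ### The multiplicative group of a model -/

/-- an elementary abelian 2-group of order 64 is `E` -/
theorem elem_ab {G : Type} [AddCommGroup G] (h2 : ∀ x : G, x + x = 0) (hc : Nat.card G = 64) :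
    ∃ e : G ≃ E, ∀ x y, e (x + y) = e x + e y := by
  letI : Module (ZMod 2) G := AddCommGroup.zmodModule (n := 2) (fun x => by rw [two_nsmul, h2])
  haveI : Finite G := Nat.finite_of_card_ne_zero (by rw [hc]; decide)
  have h := Module.natCard_eq_pow_finrank (K := ZMod 2) (V := G)
  rw [hc, Nat.card_zmod] at h
  have h6 : Module.finrank (ZMod 2) G = 6 :=
    (Nat.pow_right_injective (le_refl 2) (show 2 ^ 6 = 2 ^ Module.finrank (ZMod 2) G from h)).symm
  have hE : Module.finrank (ZMod 2) E = 6 := by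
    simp [E, Module.finrank_prod]
  let e : G ≃ₗ[ZMod 2] E := LinearEquiv.ofFinrankEq _ _ (h6.trans hE.symm)
  exact ⟨e.toEquiv, fun x y => map_add e x y⟩

theorem mulIso_br (s : Code) (hv : Valid s) : (br s hv).MulIso E := by
  have hcard : Nat.card A = 64 := by simp [A, Nat.card_prod]
  exact @elem_ab A
    { add := (br s hv).mul
      zero := (br s hv).one
      neg := fun x => x
      add_assoc := (br s hv).mul_assoc
      zero_add := (br s hv).one_mul
      add_zero := (br s hv).mul_one
      neg_add_cancel := (br s hv).inv_mul_cancel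
      add_comm := fun x y => by
        change x + y + m s x y = y + x + m s y x
        rw [m_comm, add_comm x y]
      nsmul := @nsmulRec A ⟨(br s hv).one⟩ ⟨(br s hv).mul⟩
      nsmul_zero := fun _ => rfl
      nsmul_succ := fun _ _ => rfl
      zsmul := @zsmulRec A ⟨(br s hv).one⟩ ⟨(br s hv).mul⟩ ⟨fun x => x⟩ (@nsmulRec A ⟨(br s hv).one⟩ ⟨(br s hv).mul⟩)
      zsmul_zero' := fun _ => rfl
      zsmul_succ' := fun _ _ => rfl
      zsmul_neg' := fun _ _ => rfl
      sub := fun x y => (br s hv).mul x y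
      sub_eq_add_neg := fun _ _ => rfl }
    (br s hv).inv_mul_cancel hcard

theorem iso_addIso {B C : Type} {L : LeftBrace B} {M : LeftBrace C} (h : L.Iso M) {H : Type}
    [AddGroup H] (hM : M.AddIso H) : L.AddIso H := by
  obtain ⟨e, h1, h2⟩ := h
  obtain ⟨f, hf⟩ := hM
  exact ⟨e.trans f, fun x y => by simp [h1, hf]⟩

theorem iso_mulIso {B C : Type} {L : LeftBrace B} {M : LeftBrace C} (h : L.Iso M) {H : Type}
    [AddGroup H] (hM : M.MulIso H) : L.MulIso H := by
  obtain ⟨e, h1, h2⟩ := h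
  obtain ⟨f, hf⟩ := hM
  exact ⟨e.trans f, fun x y => by simp [h2, hf]⟩

noncomputable def e64 : A ≃ Fin 64 := Fintype.equivFinOfCardEq (by simp [ZMod.card])

noncomputable def mk64 (i : Fin reps.length) : {L : LeftBrace (Fin 64) //
    L.AddIso A ∧ L.MulIso E} :=
  ⟨tr e64 (br (reps.get i) (valid_reps _ (List.get_mem reps i))),
   iso_addIso (Iso.symm (iso_tr _ _)) ⟨Equiv.refl _, fun _ _ => rfl⟩,
   iso_mulIso (Iso.symm (iso_tr _ _)) (mulIso_br _ _)⟩

theorem invL_mk64 (i : Fin reps.length) : invL (mk64 i).1 = 64 * invC (reps.get i) := by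
  rw [← invL_br _ (wf_reps _ (List.get_mem reps i)) (valid_reps _ (List.get_mem reps i))]
  exact (invL_iso (iso_tr _ _)).symm

theorem final : Nat.card (Quot (fun (L₁ L₂ : {L : LeftBrace (Fin 64) //
        L.AddIso A ∧ L.MulIso E}) => L₁.1.Iso L₂.1)) = 46 := by
  let F : Fin reps.length → Quot (fun (L₁ L₂ : {L : LeftBrace (Fin 64) //
        L.AddIso A ∧ L.MulIso E}) => L₁.1.Iso L₂.1) := fun i => Quot.mk _ (mk64 i)
  have hF : Function.Bijective F := by
    constructor
    · intro i j hij
      have h := congrArg (Quot.lift (fun L : {L : LeftBrace (Fin 64) //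
        L.AddIso A ∧ L.MulIso E} => invL L.1) (fun _ _ h => invL_iso h)) hij
      change invL (mk64 i).1 = invL (mk64 j).1 at h
      rw [invL_mk64, invL_mk64] at h
      have h' : invC (reps.get i) = invC (reps.get j) := by omega
      have hn := List.inj_on_of_nodup_map inv_nodup (List.get_mem reps i) (List.get_mem reps j) h'
      have hr : reps.Nodup := List.Nodup.of_map _ inv_nodup
      exact (List.nodup_iff_injective_get.1 hr) hn
    · intro x
      induction x using Quot.ind with
      | mk L =>
        obtain ⟨L, h1, h2⟩ := L
        obtain ⟨s, hv, hs, hL⟩ := extract L h1 h2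
        obtain ⟨r, hr, hR⟩ := reduce _ s (Nat.lt_succ_self _) hs hv
        obtain ⟨i, rfl⟩ := List.get_of_mem hr
        refine ⟨i, Quot.sound ?_⟩
        refine Iso.symm (Iso.trans hL (Iso.trans (iso_of_R hv (valid_reps _ hr) hR) ?_))
        exact iso_tr _ _
  rw [← Nat.card_congr (Equiv.ofBijective F hF), Nat.card_fin]
  rfl

end BraceCount

/-- The number of isomorphism classes of left braces with additive group
isomorphic to `C₂ × C₂ × C₄ × C₄` and multiplicative group isomorphic to
`C₂⁶` (elementary abelian of order 64) is `46`. -/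
theorem number_of_braces_by_mul_group :
    Nat.card (Quot (fun (L₁ L₂ : {L : LeftBrace (Fin 64) //
        L.AddIso (ZMod 2 × ZMod 2 × ZMod 4 × ZMod 4) ∧
        L.MulIso (ZMod 2 × ZMod 2 × ZMod 2 × ZMod 2 × ZMod 2 × ZMod 2)}) => L₁.1.Iso L₂.1)) = 46 := by
  exact BraceCount.final
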